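/- arXiv:2603.28606 — 2 statements merged into one kernel-verified Lean document; each statement's English description precedes it below -/
import Mathlib

section
/- Let r = 1 and a = (1 + √5)/2, and let f : [0,1) → ℝ be defined by f(∑_{n≥1} α_n 2^{−n}) = ∑_{n≥1} α_n a^{−n}, using for each x its binary expansion that is not eventually equal to 1. Let y₀ = ∑_{k=0}^∞ a^{−(3k+1)}. Then the level set {x ∈ [0,1) : f(x) = y₀} has the cardinality of the continuum. -/
/-- The digit sequence whose `k`-th block of three digits is `(1,0,0)` if `s k` is true and
`(0,1,1)` otherwise. -/
def blockDigits (s : ℕ → Bool) (n : ℕ) : ℕ :=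
  if n % 3 = 0 then (s (n / 3)).toNat else 1 - (s (n / 3)).toNat

theorem blockDigits_le_one (s : ℕ → Bool) (n : ℕ) : blockDigits s n ≤ 1 := by
  unfold blockDigits
  split_ifs
  · exact Bool.toNat_le _
  · omega

theorem blockDigits_zero (s : ℕ → Bool) (k : ℕ) :
    blockDigits s (3 * k) = (s k).toNat := by
  simp [blockDigits]

theorem blockDigits_one (s : ℕ → Bool) (k : ℕ) :
    blockDigits s (1 + 3 * k) = 1 - (s k).toNat := by
  have h1 : (1 + 3 * k) % 3 = 1 := by omega
  have h2 : (1 + 3 * k) / 3 = k := by omega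
  simp [blockDigits, h1, h2]

theorem blockDigits_two (s : ℕ → Bool) (k : ℕ) :
    blockDigits s (2 + 3 * k) = 1 - (s k).toNat := by
  have h1 : (2 + 3 * k) % 3 = 2 := by omega
  have h2 : (2 + 3 * k) / 3 = k := by omega
  simp [blockDigits, h1, h2]

theorem not_eventually_blockDigits_eq_one (s : ℕ → Bool) :
    ¬ ∃ N, ∀ n ≥ N, blockDigits s n = 1 := by
  rintro ⟨N, hN⟩
  have h0 := hN (3 * N) (by omega)
  have h1 := hN (1 + 3 * N) (by omega)
  rw [blockDigits_zero] at h0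
  rw [blockDigits_one] at h1
  omega

theorem summable_digits {b : ℝ} (hb : 1 < b) {α : ℕ → ℕ} (hα : ∀ n, α n ≤ 1) :
    Summable fun n : ℕ => (α n : ℝ) / b ^ (n + 1) := by
  have hb0 : 0 < b := by linarith
  refine Summable.of_nonneg_of_le (fun n => by positivity) (fun n => ?_)
    (summable_geometric_of_lt_one (inv_nonneg.2 hb0.le) (inv_lt_one_of_one_lt₀ hb))
  have h : (α n : ℝ) ≤ 1 := by exact_mod_cast hα n
  rw [inv_pow, ← one_div]
  gcongr
  · exact hb.le
  · omega

theorem tsum_blockDigits {b : ℝ} (hb : 1 < b) (s : ℕ → Bool) :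
    ∑' n : ℕ, (blockDigits s n : ℝ) / b ^ (n + 1) =
      ∑' k : ℕ, if s k then 1 / b ^ (3 * k + 1)
        else 1 / b ^ (3 * k + 2) + 1 / b ^ (3 * k + 3) := by
  have hs := summable_digits hb (blockDigits_le_one s)
  have hj (j : ℕ) : Summable fun k : ℕ =>
      (blockDigits s (j + 3 * k) : ℝ) / b ^ (j + 3 * k + 1) :=
    hs.comp_injective (i := fun k : ℕ => j + 3 * k) fun x y h => by
      simp only at h
      omega
  have e : ∑' n : ℕ, (blockDigits s n : ℝ) / b ^ (n + 1) =
      ∑' k : ℕ, (blockDigits s (0 + 3 * k) : ℝ) / b ^ (0 + 3 * k + 1) +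
      ∑' k : ℕ, (blockDigits s (1 + 3 * k) : ℝ) / b ^ (1 + 3 * k + 1) +
      ∑' k : ℕ, (blockDigits s (2 + 3 * k) : ℝ) / b ^ (2 + 3 * k + 1) := by
    rw [Nat.sumByResidueClasses hs 3]
    exact Fin.sum_univ_three _
  rw [e, ← (hj 0).tsum_add (hj 1), ← ((hj 0).add (hj 1)).tsum_add (hj 2)]
  refine tsum_congr fun k => ?_
  rw [zero_add, blockDigits_zero, blockDigits_one, blockDigits_two,
    show 1 + 3 * k + 1 = 3 * k + 2 by ring, show 2 + 3 * k + 1 = 3 * k + 3 by ring]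
  cases s k <;> simp

theorem tsum_blockDigits_two (s : ℕ → Bool) :
    ∑' n : ℕ, (blockDigits s n : ℝ) / 2 ^ (n + 1) =
      3 / 7 + Cardinal.cantorFunction (1 / 8) s / 8 := by
  have hg : HasSum (fun k : ℕ => (3 / 8 : ℝ) * (1 / 8) ^ k) (3 / 7) := by
    have h := (hasSum_geometric_of_lt_one (r := (1 / 8 : ℝ)) (by norm_num)
      (by norm_num)).mul_left (3 / 8)
    rwa [show (3 / 8 : ℝ) * (1 - 1 / 8)⁻¹ = 3 / 7 by norm_num] at h
  have hc := (Cardinal.summable_cantor_function s (c := 1 / 8) (by norm_num)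
    (by norm_num)).hasSum.div_const 8
  rw [tsum_blockDigits one_lt_two, Cardinal.cantorFunction, ← (hg.add hc).tsum_eq]
  refine tsum_congr fun k => ?_
  have h8 : (1 / 8 : ℝ) ^ k = 1 / 2 ^ (3 * k) := by
    rw [pow_mul, one_div_pow]
    norm_num
  cases h : s k <;> simp only [Cardinal.cantorFunctionAux, h, h8, pow_add, cond_true, cond_false,
    if_true, Bool.false_eq_true, if_false] <;> field_simp <;> norm_num

theorem cantorFunction_mem_Icc (s : ℕ → Bool) :
    Cardinal.cantorFunction (1 / 8) s ∈ Set.Icc (0 : ℝ) (8 / 7) := by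
  refine ⟨tsum_nonneg fun n => Cardinal.cantorFunctionAux_nonneg (by norm_num), ?_⟩
  have h := Cardinal.cantorFunction_le (c := 1 / 8) (f := s) (g := fun _ => true)
    (by norm_num) (by norm_num) (fun _ _ => rfl)
  refine h.trans_eq ?_
  simp only [Cardinal.cantorFunction, Cardinal.cantorFunctionAux, cond_true]
  rw [tsum_geometric_of_lt_one (by norm_num) (by norm_num)]
  norm_num

/-- With `r = 1` and `a = (1+√5)/2`, and `f` defined via binary
expansions not eventually equal to `1`, the level set
`{x ∈ [0,1) : f x = y₀}` with `y₀ = ∑_{k≥0} a^{-(3k+1)}` has the cardinality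
of the continuum. -/
theorem stmt_8 (a : ℝ) (ha : a = (1 + Real.sqrt 5) / 2)
    (f : ℝ → ℝ)
    (hf : ∀ α : ℕ → ℕ, (∀ n, α n ≤ 1) → (¬ ∃ N, ∀ n ≥ N, α n = 1) →
      f (∑' n : ℕ, (α n : ℝ) / 2 ^ (n + 1)) = ∑' n : ℕ, (α n : ℝ) / a ^ (n + 1)) :
    Cardinal.mk ↥{x : ℝ | x ∈ Set.Ico (0 : ℝ) 1 ∧
        f x = ∑' k : ℕ, 1 / a ^ (3 * k + 1)} = Cardinal.continuum := by
  have ha1 : 1 < a := ha ▸ Real.one_lt_goldenRatio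
  have hsq : a ^ 2 = a + 1 := ha ▸ Real.goldenRatio_sq
  have ha0 : a ≠ 0 := by positivity
  have hmem (s : ℕ → Bool) : 3 / 7 + Cardinal.cantorFunction (1 / 8) s / 8 ∈
      {x : ℝ | x ∈ Set.Ico (0 : ℝ) 1 ∧ f x = ∑' k : ℕ, 1 / a ^ (3 * k + 1)} := by
    obtain ⟨h0, h1⟩ := cantorFunction_mem_Icc s
    refine ⟨⟨by linarith, by linarith⟩, ?_⟩
    rw [← tsum_blockDigits_two, hf _ (blockDigits_le_one s)
      (not_eventually_blockDigits_eq_one s), tsum_blockDigits ha1]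
    refine tsum_congr fun k => ?_
    split_ifs
    · rfl
    · simp only [pow_add]
      field_simp
      linear_combination -hsq
  refine le_antisymm ((Cardinal.mk_set_le _).trans_eq Cardinal.mk_real) ?_
  have hinj : Function.Injective fun s : ℕ → Bool =>
      (⟨_, hmem s⟩ : {x : ℝ | x ∈ Set.Ico (0 : ℝ) 1 ∧
        f x = ∑' k : ℕ, 1 / a ^ (3 * k + 1)}) := by
    intro s t h
    have h' := congrArg Subtype.val h
    exact Cardinal.cantorFunction_injective (c := 1 / 8) (by norm_num) (by norm_num)
      (by simp only at h'; linarith)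
  have hcard : Cardinal.mk (ℕ → Bool) = Cardinal.continuum := by simp
  exact hcard.symm.trans_le (Cardinal.mk_le_of_injective hinj)
end

section
/- Fix a real a > 1 and an integer r ≥ 1 with a − 1 ≤ r. For a tuple (c_1,…,c_{k−1}) of elements of {0,1,…,r} and c ∈ {0,1,…,r−1}, the intersection Δ_{c_1…c_{k−1}c} ∩ Δ_{c_1…c_{k−1}(c+1)} equals the single rank-(k+1) cylinder Δ_{c_1…c_{k−1}c r} (equivalently, Δ_{c_1…c_{k−1}(c+1)0}) if and only if r = a; in particular this can hold only when a is a positive integer. -/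
/-- The `r_a`-cylinder of rank `k` with base `(c 0, …, c (k-1))`. -/
def raCylinder (a : ℝ) (r k : ℕ) (c : ℕ → ℕ) : Set ℝ :=
  {x : ℝ | ∃ α : ℕ → ℕ, (∀ n, α n ≤ r) ∧
    x = (∑ i ∈ Finset.range k, (c i : ℝ) / a ^ (i + 1)) +
        ∑' n : ℕ, (α n : ℝ) / a ^ (k + n + 1)}

theorem hasSum_geometric_shift {a : ℝ} (ha : 1 < a) (r : ℝ) :
    HasSum (fun n : ℕ => r / a ^ (n + 1)) (r / (a - 1)) := by
  have h0 : 0 < a := by linarith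
  have h := (hasSum_geometric_of_lt_one (inv_nonneg.2 h0.le) (inv_lt_one_of_one_lt₀ ha)).mul_left
    (r / a)
  have hf : (fun n : ℕ => r / a * a⁻¹ ^ n) = fun n : ℕ => r / a ^ (n + 1) := by
    funext n
    rw [inv_pow, pow_succ]
    field_simp
  have hv : r / a * (1 - a⁻¹)⁻¹ = r / (a - 1) := by
    rw [← div_eq_mul_inv, div_div, mul_sub, mul_inv_cancel₀ h0.ne', mul_one]
  rwa [hf, hv] at h

/-- Every point of `[0, r / (a - 1)]` has an expansion in base `a` with digits at most `r`
(the greedy one), provided `a - 1 ≤ r`. -/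
theorem exists_digits_hasSum {a : ℝ} (ha : 1 < a) {r : ℕ} (har : a - 1 ≤ r) {y : ℝ}
    (hy : y ∈ Set.Icc 0 ((r : ℝ) / (a - 1))) :
    ∃ α : ℕ → ℕ, (∀ n, α n ≤ r) ∧ HasSum (fun n => (α n : ℝ) / a ^ (n + 1)) y := by
  have h0 : 0 < a := by linarith
  have h1 : 0 < a - 1 := by linarith
  have hM : 1 ≤ (r : ℝ) / (a - 1) := (one_le_div h1).2 har
  have hMa : a * ((r : ℝ) / (a - 1)) - r = r / (a - 1) := by field_simp; ring
  let d : ℝ → ℕ := fun t => min r ⌊a * t⌋₊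
  let t : ℕ → ℝ := fun n => (fun t => a * t - d t)^[n] y
  have ht : ∀ n, t n ∈ Set.Icc 0 ((r : ℝ) / (a - 1)) := by
    intro n
    induction n with
    | zero => exact hy
    | succ n ih =>
      have hs : t (n + 1) = a * t n - d (t n) := Function.iterate_succ_apply' _ _ _
      have hpos : 0 ≤ a * t n := mul_nonneg h0.le ih.1
      have hfl := Nat.floor_le hpos
      rw [hs]
      constructor
      · have : (d (t n) : ℝ) ≤ ⌊a * t n⌋₊ := by exact_mod_cast min_le_right _ _
        linarith
      · rcases le_total r ⌊a * t n⌋₊ with h | h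
        · have hd : d (t n) = r := min_eq_left h
          rw [hd]
          have := mul_le_mul_of_nonneg_left ih.2 h0.le
          linarith
        · have hd : d (t n) = ⌊a * t n⌋₊ := min_eq_right h
          rw [hd]
          have := Nat.lt_floor_add_one (a * t n)
          linarith
  have hsum : ∀ n, ∑ i ∈ Finset.range n, (d (t i) : ℝ) / a ^ (i + 1) = y - t n / a ^ n := by
    intro n
    induction n with
    | zero => simp [t]
    | succ n ih =>
      have hs : t (n + 1) = a * t n - d (t n) := Function.iterate_succ_apply' _ _ _
      rw [Finset.sum_range_succ, ih, hs]
      field_simp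
      ring
  refine ⟨fun n => d (t n), fun n => min_le_left _ _, ?_⟩
  rw [hasSum_iff_tendsto_nat_of_nonneg (fun n => by positivity)]
  simp only [hsum]
  have hlim : Filter.Tendsto (fun n => t n / a ^ n) Filter.atTop (nhds 0) := by
    refine squeeze_zero (fun n => div_nonneg (ht n).1 (by positivity))
      (fun n => div_le_div_of_nonneg_right (ht n).2 (by positivity)) ?_
    exact Filter.Tendsto.const_div_atTop (tendsto_pow_atTop_atTop_of_one_lt ha) _
  simpa using hlim.const_sub y

theorem raCylinder_eq_Icc {a : ℝ} (ha : 1 < a) {r : ℕ} (har : a - 1 ≤ r) (k : ℕ) (c : ℕ → ℕ) :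
    raCylinder a r k c =
      Set.Icc (∑ i ∈ Finset.range k, (c i : ℝ) / a ^ (i + 1))
        ((∑ i ∈ Finset.range k, (c i : ℝ) / a ^ (i + 1)) + (r : ℝ) / (a - 1) / a ^ k) := by
  have h0 : 0 < a := by linarith
  have hk : 0 < a ^ k := by positivity
  have hshift : ∀ (α : ℕ → ℕ), ∑' n : ℕ, (α n : ℝ) / a ^ (k + n + 1) =
      (∑' n : ℕ, (α n : ℝ) / a ^ (n + 1)) / a ^ k := by
    intro α
    rw [← tsum_div_const]
    congr 1
    funext n
    rw [div_div, ← pow_add]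
    congr 2
    ring
  ext x
  constructor
  · rintro ⟨α, hα, rfl⟩
    have hg := hasSum_geometric_shift ha (r : ℝ)
    have hle : ∀ n, (α n : ℝ) / a ^ (n + 1) ≤ (r : ℝ) / a ^ (n + 1) := fun n =>
      div_le_div_of_nonneg_right (by exact_mod_cast hα n) (by positivity)
    have hnn : ∀ n, 0 ≤ (α n : ℝ) / a ^ (n + 1) := fun n => by positivity
    have hs := Summable.of_nonneg_of_le hnn hle hg.summable
    have hT : ∑' n : ℕ, (α n : ℝ) / a ^ (n + 1) ≤ r / (a - 1) := hasSum_le hle hs.hasSum hg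
    rw [hshift]
    exact ⟨le_add_of_nonneg_right (div_nonneg (tsum_nonneg hnn) hk.le), by gcongr⟩
  · rintro ⟨hx1, hx2⟩
    obtain ⟨α, hα, hs⟩ := exists_digits_hasSum ha har
      (y := (x - ∑ i ∈ Finset.range k, (c i : ℝ) / a ^ (i + 1)) * a ^ k)
      ⟨mul_nonneg (by linarith) hk.le, by rw [← le_div_iff₀ hk]; linarith⟩
    refine ⟨α, hα, ?_⟩
    rw [hshift, hs.tsum_eq, mul_div_cancel_right₀ _ hk.ne']
    ring

/-- For `a > 1`, integer `r ≥ 1` with `a - 1 ≤ r`, a tuple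
`(c_1,…,c_{k-1})` of digits in `{0,…,r}` (of length `m = k - 1`) and
`j ∈ {0,…,r-1}`, the intersection of the adjacent rank-`k` cylinders
`Δ_{c_1…c_m j}` and `Δ_{c_1…c_m (j+1)}` equals the single rank-`(k+1)` cylinder
`Δ_{c_1…c_m j r}` (equivalently `Δ_{c_1…c_m (j+1) 0}`) if and only if `r = a`. -/
theorem stmt_12 (a : ℝ) (ha : 1 < a) (r : ℕ) (hr : 1 ≤ r) (har : a - 1 ≤ r)
    (m : ℕ) (c : ℕ → ℕ) (hc : ∀ i, i < m → c i ≤ r) (j : ℕ) (hj : j < r) :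
    (raCylinder a r (m + 1) (fun i => if i = m then j else c i) ∩
        raCylinder a r (m + 1) (fun i => if i = m then j + 1 else c i) =
      raCylinder a r (m + 2)
        (fun i => if i = m then j else if i = m + 1 then r else c i)) ↔
      (r : ℝ) = a := by
  have h0 : 0 < a := by linarith
  have h1 : 0 < a - 1 := by linarith
  have hM : 1 ≤ (r : ℝ) / (a - 1) := (one_le_div h1).2 har
  have hprefix : ∀ f : ℕ → ℕ, (∀ i, i < m → f i = c i) →
      ∑ i ∈ Finset.range m, (f i : ℝ) / a ^ (i + 1) =
        ∑ i ∈ Finset.range m, (c i : ℝ) / a ^ (i + 1) := fun f hf =>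
    Finset.sum_congr rfl fun i hi => by rw [hf i (Finset.mem_range.1 hi)]
  simp only [raCylinder_eq_Icc ha har, Finset.sum_range_succ]
  rw [hprefix (fun i => if i = m then j else c i) (fun i hi => by simp [hi.ne]),
    hprefix (fun i => if i = m then j + 1 else c i) (fun i hi => by simp [hi.ne]),
    hprefix (fun i => if i = m then j else if i = m + 1 then r else c i)
      (fun i hi => by simp [hi.ne, (Nat.lt_succ_of_lt hi).ne])]
  simp only [if_true, if_neg (Nat.succ_ne_self m), Set.Icc_inter_Icc]
  set S := ∑ i ∈ Finset.range m, (c i : ℝ) / a ^ (i + 1)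
  have hp : 0 < a ^ (m + 1) := by positivity
  have hstep : ((j + 1 : ℕ) : ℝ) / a ^ (m + 1) = j / a ^ (m + 1) + 1 / a ^ (m + 1) := by
    push_cast
    ring
  have hone : 1 / a ^ (m + 1) ≤ (r : ℝ) / (a - 1) / a ^ (m + 1) := by gcongr
  have hpos : 0 < 1 / a ^ (m + 1) := by positivity
  have hright : (r : ℝ) / a ^ (m + 1 + 1) + r / (a - 1) / a ^ (m + 2) =
      r / (a - 1) / a ^ (m + 1) := by
    field_simp
    ring
  rw [hstep, max_eq_right (by linarith), min_eq_left (by linarith),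
    show S + j / a ^ (m + 1) + r / a ^ (m + 1 + 1) + r / (a - 1) / a ^ (m + 2) =
      S + j / a ^ (m + 1) + r / (a - 1) / a ^ (m + 1) by linarith]
  have hleft : (r : ℝ) / a ^ (m + 1 + 1) = 1 / a ^ (m + 1) ↔ (r : ℝ) = a := by
    rw [pow_succ a (m + 1), div_eq_div_iff (by positivity) hp.ne', one_mul, mul_comm (a ^ (m + 1)),
      mul_left_inj' hp.ne']
  rw [← hleft]
  constructor
  · intro h
    have hinf := congrArg sInf h
    have hlast : 0 ≤ (r : ℝ) / (a - 1) / a ^ (m + 2) := by positivity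
    rw [csInf_Icc (by linarith), csInf_Icc (by linarith)] at hinf
    linarith
  · intro h
    rw [h, add_assoc S, add_assoc S]
end
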